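/- Assume p = q. If A ⊆ Δ_n^+(𝔩) satisfies P_K(λ_0 − σ(A)) ≠ 0, then the first coordinate of λ_0 − σ(A) equals p, or the (k+1)-st coordinate of λ_0 − σ(A) equals p. -/

import Mathlib

open Finset

/-- Product over a block `B` of indices of `(λ_i - λ_j)/(j - i)` over pairs `i < j` in `B`. -/
def blockProd (B : Finset ℕ) (lam : ℕ → ℚ) : ℚ :=
  ∏ i ∈ B, ∏ j ∈ B, if i < j then (lam i - lam j) / ((j : ℚ) - (i : ℚ)) else 1

/-- The Weyl dimension polynomial `P_K` for `K = S(U(p) × U(q))`: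
`P_K(λ) = ∏_{1≤i<j≤p} (λ_i−λ_j)/(j−i) · ∏_{p+1≤i<j≤p+q} (λ_i−λ_j)/(j−i)`. -/
def PK (p q : ℕ) (lam : ℕ → ℚ) : ℚ :=
  blockProd (Finset.Icc 1 p) lam * blockProd (Finset.Icc (p + 1) (p + q)) lam

/-- The Weyl dimension polynomial `P_{K∩L}`, a product over the five index blocks
`{1,…,k}`, `{k+1,…,p}`, `{p+1,…,2p−k}`, `{2p−k+1,…,p+q−k}`, `{p+q−k+1,…,p+q}`. -/
def PKL (p q k : ℕ) (lam : ℕ → ℚ) : ℚ :=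
  blockProd (Finset.Icc 1 k) lam * blockProd (Finset.Icc (k + 1) p) lam *
    blockProd (Finset.Icc (p + 1) (2 * p - k)) lam *
    blockProd (Finset.Icc (2 * p - k + 1) (p + q - k)) lam *
    blockProd (Finset.Icc (p + q - k + 1) (p + q)) lam

/-- The vector `e_i − e_j` in `ℚ^n` (indices written `1,…,n`). -/
def root (i j : ℕ) : ℕ → ℚ := fun t => (if t = i then (1 : ℚ) else 0) - (if t = j then 1 else 0)

/-- `σ(S) = ∑_{β ∈ S} β`, where the finite set `S` of vectors `e_i − e_j` is encoded by the
finite set of the corresponding pairs `(i, j)`. -/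
def sigmaSum (S : Finset (ℕ × ℕ)) : ℕ → ℚ := fun t => ∑ ij ∈ S, root ij.1 ij.2 t

/-- `Δ_n^+(𝔩) = {e_i − e_j : 1 ≤ i ≤ k, p+1 ≤ j ≤ 2p−k} ∪
{e_i − e_j : k+1 ≤ i ≤ p, p+q−k+1 ≤ j ≤ p+q}`, encoded by pairs of indices. -/
def DeltaNL (p q k : ℕ) : Finset (ℕ × ℕ) :=
  (Finset.Icc 1 k ×ˢ Finset.Icc (p + 1) (2 * p - k)) ∪
    (Finset.Icc (k + 1) p ×ˢ Finset.Icc (p + q - k + 1) (p + q))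

/-- `Δ(𝔭_1) = {e_i − e_j : 1 ≤ i ≤ k, 2p−k+1 ≤ j ≤ p+q−k} ∪
{e_i − e_j : 2p−k+1 ≤ i ≤ p+q−k, k+1 ≤ j ≤ p}`, encoded by pairs of indices. -/
def DeltaP1 (p q k : ℕ) : Finset (ℕ × ℕ) :=
  (Finset.Icc 1 k ×ˢ Finset.Icc (2 * p - k + 1) (p + q - k)) ∪
    (Finset.Icc (2 * p - k + 1) (p + q - k) ×ˢ Finset.Icc (k + 1) p)

/-- The special point
`λ_0 = (q, q−1, …, q−k+1, p, p−1, …, k+1 | p−k, …, 1, q−k, …, p−k+1, k, …, 1)`. -/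
def lam0 (p q k : ℕ) : ℕ → ℚ := fun t =>
  if t ≤ k then (q : ℚ) + 1 - t
  else if t ≤ p then (p : ℚ) + k + 1 - t
  else if t ≤ 2 * p - k then 2 * (p : ℚ) - k + 1 - t
  else if t ≤ p + q - k then (q : ℚ) + 2 * p - 2 * k + 1 - t
  else (p : ℚ) + q + 1 - t

/-- The alternating double sum
`∑_{A ⊆ Δ_n^+(𝔩)} ∑_{C ⊆ Δ(𝔭_1)} (−1)^{|A|+|C|} P_K(λ − σ(A) − σ(C))`. -/
def DSum (p q k : ℕ) (lam : ℕ → ℚ) : ℚ :=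
  ∑ A ∈ (DeltaNL p q k).powerset, ∑ C ∈ (DeltaP1 p q k).powerset,
    (-1 : ℚ) ^ (A.card + C.card) *
      PK p q (fun t => lam t - sigmaSum A t - sigmaSum C t)

lemma injOn_of_blockProd_ne_zero {B : Finset ℕ} {lam : ℕ → ℚ} (h : blockProd B lam ≠ 0) :
    Set.InjOn lam B := by
  have hlt : ∀ i ∈ B, ∀ j ∈ B, i < j → lam i ≠ lam j := by
    intro i hi j hj hij heq
    have hf := Finset.prod_ne_zero_iff.mp (Finset.prod_ne_zero_iff.mp h i hi) j hj
    simp [hij, heq] at hf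
  intro i hi j hj heq
  rcases lt_trichotomy i j with hij | hij | hij
  · exact absurd heq (hlt i hi j hj hij)
  · exact hij
  · exact absurd heq.symm (hlt j hj i hi hij)

/-- If no pair of `A` has second entry `t`, then `σ(A)` at `t` counts the pairs starting at `t`. -/
lemma sigmaSum_eq_card_filter {A : Finset (ℕ × ℕ)} {t : ℕ} (h : ∀ x ∈ A, t ≠ x.2) :
    sigmaSum A t = #{x ∈ A | t = x.1} := by
  rw [Finset.card_filter, Nat.cast_sum, sigmaSum]
  refine Finset.sum_congr rfl fun x hx => ?_
  simp [root, h x hx]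

lemma card_filter_fst_le {A : Finset (ℕ × ℕ)} {t : ℕ} {J : Finset ℕ}
    (h : ∀ x ∈ A, t = x.1 → x.2 ∈ J) : #{x ∈ A | t = x.1} ≤ #J := by
  refine Finset.card_le_card_of_injOn Prod.snd (fun x hx => ?_) fun x hx y hy hxy => ?_
  · rw [Finset.mem_coe, Finset.mem_filter] at hx
    exact h x hx.1 hx.2
  · rw [Finset.mem_coe, Finset.mem_filter] at hx hy
    exact Prod.ext (hx.2.symm.trans hy.2) hxy

/-- The first `p` coordinates of `λ_0 − σ(A)` are natural numbers; those in position `t ≤ k` lie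
in `[k + 1 - t, p + 1 - t]`, the others in `[p + 1 - t, p + k + 1 - t]`. -/
lemma exists_nat_coord {p k t : ℕ} (hk : k ≤ p) (ht : t ∈ Finset.Icc 1 p)
    {A : Finset (ℕ × ℕ)} (hA : A ⊆ DeltaNL p p k) :
    ∃ m : ℕ, lam0 p p k t - sigmaSum A t = m ∧
      (t ≤ k → k + 1 ≤ m + t ∧ m + t ≤ p + 1) ∧
      (k < t → p + 1 ≤ m + t ∧ m + t ≤ p + k + 1) := by
  have hmem : ∀ x ∈ A, (1 ≤ x.1 ∧ x.1 ≤ k ∧ p + 1 ≤ x.2 ∧ x.2 ≤ 2 * p - k) ∨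
      (k + 1 ≤ x.1 ∧ x.1 ≤ p ∧ p + p - k + 1 ≤ x.2 ∧ x.2 ≤ p + p) := by
    intro x hx
    simpa [DeltaNL, and_assoc] using hA hx
  rw [Finset.mem_Icc] at ht
  rw [sigmaSum_eq_card_filter fun x hx => by have := hmem x hx; omega, lam0]
  by_cases htk : t ≤ k
  · have hc : #{x ∈ A | t = x.1} ≤ #(Finset.Icc (p + 1) (2 * p - k)) :=
      card_filter_fst_le fun x hx h => by
        have := hmem x hx
        rw [Finset.mem_Icc]
        omega
    rw [Nat.card_Icc] at hc
    refine ⟨p + 1 - t - #{x ∈ A | t = x.1}, ?_, by omega, by omega⟩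
    rw [if_pos htk, Nat.cast_sub (by omega), Nat.cast_sub (by omega)]
    push_cast
    ring
  · have hc : #{x ∈ A | t = x.1} ≤ #(Finset.Icc (p + p - k + 1) (p + p)) :=
      card_filter_fst_le fun x hx h => by
        have := hmem x hx
        rw [Finset.mem_Icc]
        omega
    rw [Nat.card_Icc] at hc
    refine ⟨p + k + 1 - t - #{x ∈ A | t = x.1}, ?_, by omega, by omega⟩
    rw [if_neg htk, if_pos ht.2, Nat.cast_sub (by omega), Nat.cast_sub (by omega)]
    push_cast
    ring

/-- Assume `p = q`. If `A ⊆ Δ_n^+(𝔩)` satisfies `P_K(λ_0 − σ(A)) ≠ 0`, then the first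
coordinate of `λ_0 − σ(A)` equals `p`, or its `(k+1)`-st coordinate equals `p`. -/
theorem stmt_9 (p k : ℕ) (hp : 1 ≤ p) (hk : k ≤ p)
    (A : Finset (ℕ × ℕ)) (hA : A ⊆ DeltaNL p p k)
    (hne : PK p p (fun t => lam0 p p k t - sigmaSum A t) ≠ 0) :
    lam0 p p k 1 - sigmaSum A 1 = (p : ℚ) ∨
    lam0 p p k (k + 1) - sigmaSum A (k + 1) = (p : ℚ) := by
  have hinj := injOn_of_blockProd_ne_zero (left_ne_zero_of_mul hne)
  choose! m hm hlow hhigh using fun t (ht : t ∈ Finset.Icc 1 p) => exists_nat_coord hk ht hA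
  have hmaps : Set.MapsTo m (Finset.Icc 1 p) (Finset.Icc 1 p) := by
    intro t ht
    have h₁ := hlow t ht
    have h₂ := hhigh t ht
    rw [Finset.mem_coe, Finset.mem_Icc] at ht ⊢
    omega
  have hminj : Set.InjOn m (Finset.Icc 1 p) := by
    intro s hs t ht hst
    refine hinj hs ht ?_
    simp only [hm s hs, hm t ht, hst]
  obtain ⟨t, ht, hmt⟩ := Finset.surjOn_of_injOn_of_card_le m hmaps hminj le_rfl
    (Finset.mem_coe.mpr (Finset.mem_Icc.mpr ⟨hp, le_rfl⟩))
  have hcoord := hm t ht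
  have h₁ := hlow t ht
  have h₂ := hhigh t ht
  rw [hmt] at hcoord h₁ h₂
  rw [Finset.mem_coe, Finset.mem_Icc] at ht
  rcases (by omega : t = 1 ∨ t = k + 1) with rfl | rfl
  · exact Or.inl hcoord
  · exact Or.inr hcoord
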